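/- In the setting of Problem 1, choose μ > 0, α̲ > 0 and β ≥ 0 satisfying μ(σ − L_{∇g}α̲) > β(μ² + 1), define M_1 = (σ − ᾱL_{∇g})/(2ᾱ) − μβ/(2α̲) and M_2 = β/(2μα̲), and choose ᾱ > α̲ such that M_1 > M_2. Assume that f + g is bounded from below and that the sequence (x_n)_{n∈ℕ} generated by Algorithm 1 is bounded. Define H : ℝ^m × ℝ^m → (−∞,+∞] by H(x,y) = (f+g)(x) + M_2‖x−y‖², and assume H is a KL function. Then ∑_{n∈ℕ} ‖x_{n+1} − x_n‖ < +∞, and there exists a critical point x of f + g such that x_n → x as n → +∞. -/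

import Mathlib

open Filter Topology RealInnerProductSpace

noncomputable section

variable {E : Type*} [NormedAddCommGroup E] [InnerProductSpace ℝ E]

/-- The Fréchet (viscosity) subdifferential of an extended-real-valued function `h` at `x`:
`v` belongs to it iff `x ∈ dom h` and
`liminf_{y → x} (h y - h x - ⟪v, y - x⟫)/‖y - x‖ ≥ 0`, expressed equivalently by the
epsilon-characterization of the liminf. -/
def frechetSubdiff (h : E → EReal) (x : E) : Set E :=
  {v | h x ≠ ⊤ ∧ ∀ ε : ℝ, 0 < ε →
    ∀ᶠ y in 𝓝 x, (((h x).toReal + ⟪v, y - x⟫ - ε * ‖y - x‖ : ℝ) : EReal) ≤ h y}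

/-- The limiting (Mordukhovich) subdifferential of `h` at `x`. -/
def limitingSubdiff (h : E → EReal) (x : E) : Set E :=
  {v | h x ≠ ⊤ ∧ ∃ xk vk : ℕ → E,
    Tendsto xk atTop (𝓝 x) ∧
    Tendsto (fun k => h (xk k)) atTop (𝓝 (h x)) ∧
    (∀ k, vk k ∈ frechetSubdiff h (xk k)) ∧
    Tendsto vk atTop (𝓝 v)}

/-- The Kurdyka–Łojasiewicz property of `h` at a point `xb` with nonempty limiting
subdifferential. -/
def KLAt (h : E → EReal) (xb : E) : Prop :=
  ∃ η : EReal, 0 < η ∧ ∃ U ∈ 𝓝 xb, ∃ φ φ' : ℝ → ℝ,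
    φ 0 = 0 ∧
    ConcaveOn ℝ {s : ℝ | 0 ≤ s ∧ (s : EReal) < η} φ ∧
    ContinuousOn φ {s : ℝ | 0 ≤ s ∧ (s : EReal) < η} ∧
    (∀ s : ℝ, 0 < s → (s : EReal) < η → HasDerivAt φ (φ' s) s) ∧
    ContinuousOn φ' {s : ℝ | 0 < s ∧ (s : EReal) < η} ∧
    (∀ s : ℝ, 0 < s → (s : EReal) < η → 0 < φ' s) ∧
    ∀ z ∈ U, h xb < h z → h z < h xb + η →
      1 ≤ ENNReal.ofReal (φ' ((h z - h xb).toReal)) *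
        EMetric.infEdist (0 : E) (limitingSubdiff h z)

/-- `h` is a KL function if it has the KL property at every point of the domain of its
limiting subdifferential. -/
def KLFunction (h : E → EReal) : Prop :=
  ∀ xb : E, (limitingSubdiff h xb).Nonempty → KLAt h xb

section Subdifferential

theorem frechetSubdiff_subset_limitingSubdiff (h : E → EReal) (x : E) :
    frechetSubdiff h x ⊆ limitingSubdiff h x := fun v hv =>
  ⟨hv.1, fun _ => x, fun _ => v, tendsto_const_nhds, tendsto_const_nhds, fun _ => hv,
    tendsto_const_nhds⟩

theorem zero_mem_frechetSubdiff_of_forall_le {h : E → EReal} {x : E} (hmin : ∀ y, h x ≤ h y)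
    (htop : h x ≠ ⊤) (hbot : h x ≠ ⊥) : (0 : E) ∈ frechetSubdiff h x := by
  refine ⟨htop, fun ε hε => Eventually.of_forall fun y => le_trans ?_ (hmin y)⟩
  conv_rhs => rw [← EReal.coe_toReal htop hbot]
  rw [EReal.coe_le_coe_iff, inner_zero_left]
  have := mul_nonneg hε.le (norm_nonneg (y - x))
  linarith

theorem add_mem_frechetSubdiff [CompleteSpace E] {h : E → EReal} {x v q : E} {ψ : E → ℝ}
    (hv : v ∈ frechetSubdiff h x) (hbot : h x ≠ ⊥) (hψ : HasGradientAt ψ q x) :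
    v + q ∈ frechetSubdiff (fun y => h y + (ψ y : EReal)) x := by
  obtain ⟨htop, hv⟩ := hv
  refine ⟨EReal.add_ne_top htop (EReal.coe_ne_top _), fun ε hε => ?_⟩
  have hlittle := (hasGradientAt_iff_isLittleO.1 hψ).def (half_pos hε)
  filter_upwards [hv (ε / 2) (half_pos hε), hlittle] with y hy hy'
  have h2 : ψ x + ⟪q, y - x⟫ - ε / 2 * ‖y - x‖ ≤ ψ y := by
    have := neg_le_of_abs_le hy'
    linarith
  refine le_trans ?_ (add_le_add hy (EReal.coe_le_coe_iff.2 h2))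
  rw [← EReal.coe_add, EReal.coe_le_coe_iff, EReal.toReal_add htop hbot (EReal.coe_ne_top _)
    (EReal.coe_ne_bot _), EReal.toReal_coe, inner_add_left]
  linarith

theorem toLp_mem_frechetSubdiff_comp_fst {E' : Type*} [NormedAddCommGroup E']
    [InnerProductSpace ℝ E'] {f : E → EReal} {a v : E} (hv : v ∈ frechetSubdiff f a) (b : E') :
    WithLp.toLp 2 (v, (0 : E')) ∈
      frechetSubdiff (fun p : WithLp 2 (E × E') => f p.fst) (WithLp.toLp 2 (a, b)) := by
  refine ⟨hv.1, fun ε hε => ?_⟩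
  have hfst : Tendsto (fun p : WithLp 2 (E × E') => p.fst) (𝓝 (WithLp.toLp 2 (a, b))) (𝓝 a) :=
    (WithLp.fstL 2 ℝ E E').continuous.tendsto (WithLp.toLp 2 (a, b))
  filter_upwards [hfst.eventually (hv.2 ε hε)] with p hp
  refine le_trans (EReal.coe_le_coe_iff.2 ?_) hp
  have h1 := WithLp.norm_fst_le _ (p - WithLp.toLp 2 (a, b))
  have h2 := mul_le_mul_of_nonneg_left h1 hε.le
  simp only [WithLp.prod_inner_apply, WithLp.sub_fst] at h2 ⊢
  simp only [inner_zero_left, add_zero]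
  change _ ≤ (f a).toReal + ⟪v, p.fst - a⟫ - ε * ‖p.fst - a‖
  change ε * ‖p.fst - a‖ ≤ _ at h2
  linarith!

end Subdifferential

section SmoothInequalities

variable [CompleteSpace E]

theorem hasDerivAt_comp_add_smul {f : E → ℝ} (hf : Differentiable ℝ f) (w v : E) (t : ℝ) :
    HasDerivAt (fun s : ℝ => f (w + s • v)) ⟪gradient f (w + t • v), v⟫ t := by
  have h1 : HasDerivAt (fun s : ℝ => w + s • v) v t := by
    simpa using ((hasDerivAt_id t).smul_const v).const_add w
  have h2 := (hf (w + t • v)).hasFDerivAt.comp_hasDerivAt t h1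
  rwa [← inner_gradient_left] at h2

theorem le_add_inner_add_of_lipschitz_gradient {g : E → ℝ} {L : ℝ} (hg : Differentiable ℝ g)
    (hL : ∀ z w, ‖gradient g z - gradient g w‖ ≤ L * ‖z - w‖) (w u : E) :
    g u ≤ g w + ⟪gradient g w, u - w⟫ + L / 2 * ‖u - w‖ ^ 2 := by
  set v := u - w with hv
  have hd : ∀ t : ℝ, HasDerivAt
      (fun s : ℝ => g (w + s • v) - s * ⟪gradient g w, v⟫ - s ^ 2 * (L / 2 * ‖v‖ ^ 2))
      (⟪gradient g (w + t • v), v⟫ - ⟪gradient g w, v⟫ - 2 * t * (L / 2 * ‖v‖ ^ 2)) t := by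
    intro t
    have h1 := hasDerivAt_comp_add_smul hg w v t
    have h2 := (hasDerivAt_id t).mul_const ⟪gradient g w, v⟫
    have h3 := ((hasDerivAt_pow 2 t)).mul_const (L / 2 * ‖v‖ ^ 2)
    simpa using (h1.fun_sub h2).fun_sub h3
  have hanti := antitoneOn_of_deriv_nonpos (convex_Icc (0 : ℝ) 1)
    (fun t _ => (hd t).continuousAt.continuousWithinAt)
    (fun t _ => (hd t).differentiableAt.differentiableWithinAt) (fun t ht => by
      rw [interior_Icc] at ht
      rw [(hd t).deriv, ← inner_sub_left]
      have h1 := real_inner_le_norm (gradient g (w + t • v) - gradient g w) v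
      have h2 := hL (w + t • v) w
      rw [add_sub_cancel_left, norm_smul, Real.norm_of_nonneg ht.1.le] at h2
      nlinarith [mul_le_mul_of_nonneg_right h2 (norm_nonneg v)])
  have := hanti (Set.left_mem_Icc.2 zero_le_one) (Set.right_mem_Icc.2 zero_le_one) zero_le_one
  simp only [one_smul, zero_smul, hv, add_sub_cancel, add_zero] at this
  rw [hv]
  linarith

theorem strongly_convex_le_bregman {F : E → ℝ} {σ : ℝ}
    (hconv : ConvexOn ℝ Set.univ fun z => F z - σ / 2 * ‖z‖ ^ 2) (hF : Differentiable ℝ F)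
    (w u : E) : σ / 2 * ‖u - w‖ ^ 2 ≤ F u - F w - ⟪gradient F w, u - w⟫ := by
  set v := u - w with hv
  have hu : u = w + v := by simp [hv]
  have hK : ConvexOn ℝ Set.univ
      (fun s : ℝ => F (w + s • v) - σ / 2 * ‖w + s • v‖ ^ 2) := by
    have := hconv.comp_affineMap (AffineMap.lineMap w (w + v) : ℝ →ᵃ[ℝ] E)
    simpa only [Function.comp_def, AffineMap.lineMap_apply, vsub_eq_sub, vadd_eq_add,
      add_sub_cancel_left, add_comm _ w, Set.preimage_univ] using this
  have hd : HasDerivAt (fun s : ℝ => F (w + s • v) - σ / 2 * ‖w + s • v‖ ^ 2)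
      (⟪gradient F w, v⟫ - σ / 2 * (2 * ⟪w, v⟫)) 0 := by
    have h1 := hasDerivAt_comp_add_smul hF w v 0
    have h2 : HasDerivAt (fun s : ℝ => w + s • v) v 0 := by
      simpa using ((hasDerivAt_id (0 : ℝ)).smul_const v).const_add w
    have h3 := h2.norm_sq.const_mul (σ / 2)
    simpa using h1.fun_sub h3
  have := hK.le_slope_of_hasDerivAt (Set.mem_univ 0) (Set.mem_univ 1) zero_lt_one hd
  rw [slope_def_field] at this
  simp only [one_smul, zero_smul, add_zero, sub_zero, div_one] at this
  rw [norm_add_sq_real] at this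
  rw [hu]
  linarith

end SmoothInequalities

section FiniteLength

/-- A sequence whose steps are controlled by the two previous steps and a telescoping term, as long
as it stays in a ball, never leaves that ball when it starts close enough to its centre. -/
theorem summable_dist_of_local_step {X : Type*} [PseudoMetricSpace X] {x : ℕ → X} {c : X} {r K : ℝ}
    {e : ℕ → ℝ} (hK : 0 ≤ K) (he : ∀ n, 0 ≤ e n)
    (hstep : ∀ n, dist (x (n + 1)) c < r → dist (x (n + 2)) c < r →
      dist (x (n + 2)) (x (n + 3)) ≤
        (dist (x (n + 1)) (x (n + 2)) + dist (x n) (x (n + 1))) / 4 + K * (e n - e (n + 1)))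
    (hinit : dist (x 1) c + (2 * dist (x 1) (x 2) + dist (x 0) (x 1) / 2 + 2 * K * e 0) < r) :
    Summable fun n => dist (x n) (x (n + 1)) := by
  have key : ∀ n, ∑ i ∈ Finset.range n, dist (x (i + 1)) (x (i + 2)) +
      2 * dist (x (n + 1)) (x (n + 2)) + dist (x n) (x (n + 1)) / 2 + 2 * K * e n ≤
      2 * dist (x 1) (x 2) + dist (x 0) (x 1) / 2 + 2 * K * e 0 := by
    intro n
    induction n with
    | zero => simp
    | succ n ih =>
      have h1 : dist (x 1) (x (n + 1)) ≤ ∑ i ∈ Finset.range n, dist (x (i + 1)) (x (i + 2)) := by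
        simpa using dist_le_range_sum_dist (fun i => x (i + 1)) n
      have hKe := mul_nonneg hK (he n)
      have hd1 : 0 ≤ dist (x (n + 1)) (x (n + 2)) := dist_nonneg
      have hd0 : 0 ≤ dist (x n) (x (n + 1)) := dist_nonneg
      have h2 := dist_triangle_left (x (n + 1)) c (x 1)
      have h3 := dist_triangle_left (x (n + 2)) c (x (n + 1))
      have := hstep n (by linarith)
        (by linarith)
      rw [Finset.sum_range_succ]
      simp only [add_assoc, Nat.reduceAdd] at this ih ⊢
      linarith
  refine (summable_nat_add_iff 1).1 (summable_of_sum_range_le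
    (c := 2 * dist (x 1) (x 2) + dist (x 0) (x 1) / 2 + 2 * K * e 0) (fun n => dist_nonneg)
    fun n => ?_)
  have := key n
  have hKe := mul_nonneg hK (he n)
  simp only [add_assoc, Nat.reduceAdd] at this ⊢
  have hd1 : 0 ≤ dist (x (n + 1)) (x (n + 2)) := dist_nonneg
  have hd0 : 0 ≤ dist (x n) (x (n + 1)) := dist_nonneg
  linarith

/-- Along a sequence with decreasing values, the KL inequality bounds the decrease by a telescoping
sequence times the norm of a subgradient. -/
theorem KLAt.exists_telescoping {h : E → EReal} {zb : E} (hKL : KLAt h zb) {ℓ : ℝ}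
    (hzb : h zb = ℓ) {z w : ℕ → E} {hv : ℕ → ℝ} (hz : ∀ n, h (z n) = hv n) (hanti : Antitone hv)
    (hlim : Tendsto hv atTop (𝓝 ℓ)) (hw : ∀ n, w n ∈ frechetSubdiff h (z n)) :
    ∃ U ∈ 𝓝 zb, ∃ e : ℕ → ℝ, Tendsto e atTop (𝓝 0) ∧ ∀ᶠ n in atTop,
      0 ≤ e n ∧ e (n + 1) ≤ e n ∧ (z n ∈ U → hv n - hv (n + 1) ≤ (e n - e (n + 1)) * ‖w n‖) := by
  obtain ⟨η, hη, U, hU, φ, φ', hφ0, hconc, hcont, hderiv, -, hpos, hineq⟩ := hKL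
  have hge : ∀ n, ℓ ≤ hv n := hanti.le_of_tendsto hlim
  have hlt : ∀ᶠ n in atTop, ((hv n - ℓ : ℝ) : EReal) < η := by
    have h1 : Tendsto (fun n => ((hv n - ℓ : ℝ) : EReal)) atTop (𝓝 ((0 : ℝ) : EReal)) := by
      refine (continuous_coe_real_ereal.tendsto 0).comp ?_
      simpa using hlim.sub_const ℓ
    exact h1.eventually_lt_const hη
  have htan : ∀ s t : ℝ, 0 ≤ t → t ≤ s → 0 < s → (s : EReal) < η →
      φ' s * (s - t) ≤ φ s - φ t := by
    intro s t ht hts hs hsη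
    rcases hts.eq_or_lt with rfl | hlt'
    · simp
    have := hconc.le_slope_of_hasDerivAt (x := t) (y := s)
      ⟨ht, (EReal.coe_le_coe_iff.2 hts).trans_lt hsη⟩ ⟨hs.le, hsη⟩ hlt' (hderiv s hs hsη)
    rw [slope_def_field, le_div_iff₀ (sub_pos.2 hlt')] at this
    exact this
  refine ⟨U, hU, fun n => φ (hv n - ℓ), ?_, ?_⟩
  · have h0 : ContinuousWithinAt φ {s : ℝ | 0 ≤ s ∧ (s : EReal) < η} 0 := hcont 0 ⟨le_rfl, hη⟩
    have h1 : Tendsto (fun n => hv n - ℓ) atTop (𝓝[{s : ℝ | 0 ≤ s ∧ (s : EReal) < η}] 0) := by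
      refine tendsto_nhdsWithin_iff.2 ⟨by simpa using hlim.sub_const ℓ, ?_⟩
      filter_upwards [hlt] with n hn using ⟨sub_nonneg.2 (hge n), hn⟩
    simpa only [Function.comp_def, hφ0] using h0.tendsto.comp h1
  · filter_upwards [hlt] with n hn
    have hn1 : hv (n + 1) ≤ hv n := hanti n.le_succ
    rcases (hge n).eq_or_lt with heq | hgt
    · have : hv (n + 1) = hv n := le_antisymm hn1 (heq ▸ hge _)
      simp [this, ← heq, hφ0]
    have hs : 0 < hv n - ℓ := sub_pos.2 hgt
    have hφ' := hpos _ hs hn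
    have ht0 := htan _ 0 le_rfl hs.le hs hn
    have ht1 := htan _ (hv (n + 1) - ℓ) (sub_nonneg.2 (hge _)) (by linarith) hs hn
    rw [sub_sub_sub_cancel_right] at ht1
    have hdec : 0 ≤ φ' (hv n - ℓ) * (hv n - hv (n + 1)) :=
      mul_nonneg hφ'.le (sub_nonneg.2 hn1)
    refine ⟨?_, by linarith, fun hzU => ?_⟩
    · rw [hφ0] at ht0
      linarith [mul_pos hφ' hs]
    have hkl := hineq (z n) hzU (by rw [hz, hzb]; exact EReal.coe_lt_coe_iff.2 hgt) (by
      rw [hz, hzb]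
      calc (hv n : EReal) = (ℓ : EReal) + ((hv n - ℓ : ℝ) : EReal) := by
            rw [← EReal.coe_add]; congr 1; ring
        _ < ℓ + η := EReal.add_lt_add_left_coe hn ℓ)
    have hle : EMetric.infEdist (0 : E) (limitingSubdiff h (z n)) ≤ ENNReal.ofReal ‖w n‖ := by
      refine (Metric.infEDist_le_edist_of_mem
        (frechetSubdiff_subset_limitingSubdiff h (z n) (hw n))).trans ?_
      rw [edist_dist, dist_zero_left]
    have h1 := hkl.trans (mul_le_mul_right hle _)
    rw [hz, hzb, ← EReal.coe_sub, EReal.toReal_coe, ← ENNReal.ofReal_mul hφ'.le,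
      ENNReal.one_le_ofReal] at h1
    calc hv n - hv (n + 1) ≤ (hv n - hv (n + 1)) * (φ' (hv n - ℓ) * ‖w n‖) :=
          le_mul_of_one_le_right (sub_nonneg.2 hn1) h1
      _ = φ' (hv n - ℓ) * (hv n - hv (n + 1)) * ‖w n‖ := by ring
      _ ≤ _ := mul_le_mul_of_nonneg_right ht1 (norm_nonneg _)

theorem tendsto_dist_of_sufficient_decrease {X : Type*} [PseudoMetricSpace X] {x : ℕ → X}
    {hv : ℕ → ℝ} {C ℓ : ℝ} (hC : 0 < C)
    (hdesc : ∀ n, hv (n + 1) + C * dist (x (n + 2)) (x (n + 3)) ^ 2 ≤ hv n)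
    (hlim : Tendsto hv atTop (𝓝 ℓ)) : Tendsto (fun n => dist (x n) (x (n + 1))) atTop (𝓝 0) := by
  rw [← tendsto_add_atTop_iff_nat 2]
  have h1 : Tendsto (fun n => (hv n - hv (n + 1)) / C) atTop (𝓝 0) := by
    simpa using (hlim.sub (hlim.comp (tendsto_add_atTop_nat 1))).div_const C
  have h2 : Tendsto (fun n => dist (x (n + 2)) (x (n + 3)) ^ 2) atTop (𝓝 0) := by
    refine squeeze_zero (fun n => sq_nonneg _) (fun n => ?_) h1
    rw [le_div_iff₀ hC]
    linarith [hdesc n]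
  have h3 := h2.sqrt
  simpa only [Real.sqrt_sq dist_nonneg, Real.sqrt_zero] using h3

/-- Sufficient decrease, a relative error bound and the KL property at a cluster point give finite
length and convergence. -/
theorem KLAt.summable_dist_and_tendsto [CompleteSpace E] {H : WithLp 2 (E × E) → EReal} {x : ℕ → E}
    {hv : ℕ → ℝ} {w : ℕ → WithLp 2 (E × E)} {C N ℓ : ℝ} {xb : E} {φ : ℕ → ℕ} (hC : 0 < C)
    (hN : 0 ≤ N) (hKL : KLAt H (WithLp.toLp 2 (xb, xb)))
    (hHb : H (WithLp.toLp 2 (xb, xb)) = ℓ)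
    (hH : ∀ n, H (WithLp.toLp 2 (x (n + 2), x (n + 1))) = hv n)
    (hdesc : ∀ n, hv (n + 1) + C * dist (x (n + 2)) (x (n + 3)) ^ 2 ≤ hv n)
    (hlim : Tendsto hv atTop (𝓝 ℓ))
    (hw : ∀ n, w n ∈ frechetSubdiff H (WithLp.toLp 2 (x (n + 2), x (n + 1))))
    (hwN : ∀ n, ‖w n‖ ≤ N * (dist (x (n + 1)) (x (n + 2)) + dist (x n) (x (n + 1))))
    (hφ : StrictMono φ) (hxφ : Tendsto (x ∘ φ) atTop (𝓝 xb)) :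
    (Summable fun n => dist (x n) (x (n + 1))) ∧ Tendsto x atTop (𝓝 xb) := by
  have hanti : Antitone hv := antitone_nat_of_succ_le fun n => by
    have := hdesc n
    have := mul_nonneg hC.le (sq_nonneg (dist (x (n + 2)) (x (n + 3))))
    linarith
  have hD := tendsto_dist_of_sufficient_decrease hC hdesc hlim
  obtain ⟨U, hU, e, he0, hev⟩ := hKL.exists_telescoping hHb hH hanti hlim hw
  obtain ⟨r, hr, hrU⟩ : ∃ r > 0, ∀ a b, dist a xb < r → dist b xb < r →
      WithLp.toLp 2 (a, b) ∈ U := by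
    obtain ⟨r, hr, hrU⟩ := Metric.mem_nhds_iff.1
      ((WithLp.prod_continuous_toLp 2 E E).tendsto (xb, xb) hU)
    exact ⟨r, hr, fun a b ha hb => hrU (by simp [Prod.dist_eq, ha, hb])⟩
  obtain ⟨n₀, hn₀⟩ := eventually_atTop.1 hev
  set K := N / C with hKdef
  have hK : 0 ≤ K := div_nonneg hN hC.le
  have hφt := hφ.tendsto_atTop
  have hinit : Tendsto (fun j => dist (x (φ j + 1)) xb + (2 * dist (x (φ j + 1)) (x (φ j + 2)) +
      dist (x (φ j)) (x (φ j + 1)) / 2 + 2 * K * e (φ j))) atTop (𝓝 0) := by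
    have h1 : Tendsto (fun j => dist (x (φ j)) (x (φ j + 1))) atTop (𝓝 0) := hD.comp hφt
    have h2 : Tendsto (fun j => dist (x (φ j + 1)) (x (φ j + 2))) atTop (𝓝 0) :=
      ((tendsto_add_atTop_iff_nat 1).2 hD).comp hφt
    have h3 : Tendsto (fun j => dist (x (φ j + 1)) xb) atTop (𝓝 0) := by
      refine squeeze_zero (fun _ => dist_nonneg) (fun j => dist_triangle_left _ _ (x (φ j))) ?_
      simpa using h1.add (tendsto_iff_dist_tendsto_zero.1 hxφ)
    simpa using h3.add (((h2.const_mul 2).add (h1.div_const 2)).add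
      ((he0.comp hφt).const_mul (2 * K)))
  obtain ⟨j, hj, hjr⟩ := ((hφt.eventually_ge_atTop n₀).and (hinit.eventually_lt_const hr)).exists
  have hsum : Summable fun n => dist (x n) (x (n + 1)) := by
    rw [← summable_nat_add_iff (φ j)]
    have := summable_dist_of_local_step (x := fun n => x (n + φ j)) (c := xb) (r := r) (K := K)
      (e := fun n => e (n + φ j)) hK (fun n => (hn₀ _ (by omega)).1) (fun n h1 h2 => ?_) ?_
    · simpa only [add_right_comm _ 1] using this
    · obtain ⟨-, hmono, hle⟩ := hn₀ (n + φ j) (by omega)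
      simp only [add_right_comm n _ (φ j)] at h1 h2 ⊢
      have hle := hle (hrU _ _ h2 h1)
      set m := n + φ j
      set a := dist (x (m + 1)) (x (m + 2)) + dist (x m) (x (m + 1))
      have ha : 0 ≤ a := add_nonneg dist_nonneg dist_nonneg
      have hb : 0 ≤ K * (e m - e (m + 1)) := mul_nonneg hK (sub_nonneg.2 hmono)
      have h3 : dist (x (m + 2)) (x (m + 3)) ^ 2 ≤ a * (K * (e m - e (m + 1))) := by
        have h4 := mul_le_mul_of_nonneg_left (hwN m) (sub_nonneg.2 hmono)
        have h5 : a * (K * (e m - e (m + 1))) = (e m - e (m + 1)) * (N * a) / C := by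
          rw [hKdef]; ring
        rw [h5, le_div_iff₀ hC]
        linarith [hdesc m]
      refine (pow_le_pow_iff_left₀ dist_nonneg (by positivity) two_ne_zero).1 (h3.trans ?_)
      nlinarith [sq_nonneg (a / 4 - K * (e m - e (m + 1)))]
    · simpa only [zero_add, add_zero, add_comm _ (φ j)] using hjr
  exact ⟨hsum, tendsto_nhds_of_cauchySeq_of_subseq (cauchySeq_of_summable_dist hsum) hφt hxφ⟩

end FiniteLength

theorem LowerSemicontinuous.le_of_tendsto_comp {X Y ι : Type*} [TopologicalSpace X]
    [TopologicalSpace Y] [LinearOrder Y] [DenselyOrdered Y] [OrderClosedTopology Y] {f : X → Y}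
    (hf : LowerSemicontinuous f) {l : Filter ι} [l.NeBot] {u : ι → X} {a : X} {c : Y}
    (hu : Tendsto u l (𝓝 a)) (hfu : Tendsto (fun i => f (u i)) l (𝓝 c)) : f a ≤ c :=
  le_of_forall_lt_imp_le_of_dense fun b hb =>
    ge_of_tendsto hfu ((hu.eventually (hf a b hb)).mono fun _ h => h.le)

section BregmanStep

theorem norm_toLp_add_toLp_le {V : Type*} [SeminormedAddCommGroup V] (p c : V) :
    ‖WithLp.toLp 2 (p, (0 : V)) + WithLp.toLp 2 (c, -c)‖ ≤ ‖p‖ + 2 * ‖c‖ := by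
  have h : WithLp.toLp 2 (c, -c) = WithLp.toLp 2 (c, (0 : V)) + WithLp.toLp 2 ((0 : V), -c) := by
    rw [← WithLp.toLp_add]
    simp
  rw [h]
  refine (norm_add_le _ _).trans ?_
  have := norm_add_le (WithLp.toLp 2 (c, (0 : V))) (WithLp.toLp 2 ((0 : V), -c))
  rw [WithLp.norm_toLp_fst, WithLp.norm_toLp_snd, norm_neg] at this
  rw [WithLp.norm_toLp_fst]
  linarith

theorem ne_top_and_forall_add_le_of_minimizer {X : Type*} {f : X → EReal} (hbot : ∀ z, f z ≠ ⊥)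
    (hproper : ∃ z, f z ≠ ⊤) {a : ℝ} (ha : 0 < a) {A : X → ℝ} {y : X}
    (hmin : ∀ u, (A y : EReal) + (a : EReal) * f y ≤ (A u : EReal) + (a : EReal) * f u) :
    f y ≠ ⊤ ∧ ∀ u, f y + ((a⁻¹ * A y : ℝ) : EReal) ≤ f u + ((a⁻¹ * A u : ℝ) : EReal) := by
  have hy : f y ≠ ⊤ := by
    intro hy
    obtain ⟨z, hz⟩ := hproper
    have h := hmin z
    lift f z to ℝ using ⟨hz, hbot z⟩ with b
    rw [hy, EReal.coe_mul_top_of_pos ha, EReal.coe_add_top, top_le_iff, ← EReal.coe_mul,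
      ← EReal.coe_add] at h
    exact EReal.coe_ne_top _ h
  refine ⟨hy, fun u => ?_⟩
  rcases eq_or_ne (f u) ⊤ with hu | hu
  · rw [hu, EReal.top_add_coe]
    exact le_top
  have h := hmin u
  have hyb := hbot y
  have hub := hbot u
  lift f y to ℝ using ⟨hy, hyb⟩ with c
  lift f u to ℝ using ⟨hu, hub⟩ with b
  norm_cast at h ⊢
  have := mul_le_mul_of_nonneg_left h (inv_pos.2 ha).le
  rw [mul_add, mul_add, inv_mul_cancel_left₀ ha.ne', inv_mul_cancel_left₀ ha.ne'] at this
  linarith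

/-- The smooth part of the objective minimized in one step of the algorithm. -/
def stepObjective [CompleteSpace E] (F g : E → ℝ) (a b : ℝ) (yp y u : E) : ℝ :=
  F u - F y - ⟪gradient F y, u - y⟫ + a * ⟪u, gradient g y⟫ + b * ⟪u, yp - y⟫

variable [CompleteSpace E] {F g : E → ℝ}

theorem hasGradientAt_stepObjective (hF : Differentiable ℝ F) (a b : ℝ) (yp y u : E) :
    HasGradientAt (stepObjective F g a b yp y)
      (gradient F u - gradient F y + a • gradient g y + b • (yp - y)) u := by
  have h0 := hasGradientAt_iff_hasFDerivAt.1 (hF u).hasGradientAt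
  have h1 : HasFDerivAt (fun u : E => ⟪gradient F y, u - y⟫) (innerSL ℝ (gradient F y)) u := by
    simp only [inner_sub_right]
    exact ((innerSL ℝ (gradient F y)).hasFDerivAt (x := u)).sub_const ⟪gradient F y, y⟫
  have hlin : ∀ c : E, HasFDerivAt (fun u : E => ⟪u, c⟫) (innerSL ℝ c) u := fun c => by
    simp only [fun u : E => real_inner_comm c u]
    exact (innerSL ℝ c).hasFDerivAt (x := u)
  rw [hasGradientAt_iff_hasFDerivAt]
  refine ((((h0.sub_const (F y)).sub h1).add ((hlin (gradient g y)).const_mul a)).add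
    ((hlin (yp - y)).const_mul b)).congr_fderiv ?_
  ext v
  simp

theorem gradient_sub_mem_frechetSubdiff_add {f : E → EReal} {a b : ℝ} {yp y y' : E}
    (hF : Differentiable ℝ F) (hg : Differentiable ℝ g) (htop : f y' ≠ ⊤) (hbot : f y' ≠ ⊥)
    (hmin : ∀ u, f y' + ((a⁻¹ * stepObjective F g a b yp y y' : ℝ) : EReal) ≤
      f u + ((a⁻¹ * stepObjective F g a b yp y u : ℝ) : EReal)) :
    gradient g y' - a⁻¹ • (gradient F y' - gradient F y + a • gradient g y + b • (yp - y)) ∈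
      frechetSubdiff (fun u => f u + (g u : EReal)) y' := by
  set ψ : E → ℝ := fun u => a⁻¹ * stepObjective F g a b yp y u with hψ
  have h0 := zero_mem_frechetSubdiff_of_forall_le
    (h := fun u => f u + ((ψ u : ℝ) : EReal)) hmin
    (EReal.add_ne_top htop (EReal.coe_ne_top _))
    (EReal.add_ne_bot_iff.2 ⟨hbot, EReal.coe_ne_bot _⟩)
  have hgrad : HasGradientAt (fun u => g u - ψ u) (gradient g y' -
      a⁻¹ • (gradient F y' - gradient F y + a • gradient g y + b • (yp - y))) y' := by
    rw [hasGradientAt_iff_hasFDerivAt]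
    refine ((hasGradientAt_iff_hasFDerivAt.1 (hg y').hasGradientAt).sub
      ((hasGradientAt_iff_hasFDerivAt.1
        (hasGradientAt_stepObjective (g := g) hF a b yp y y')).const_mul a⁻¹)).congr_fderiv ?_
    rw [map_sub, map_smulₛₗ]
    simp
  have h1 := add_mem_frechetSubdiff h0
    (EReal.add_ne_bot_iff.2 ⟨hbot, EReal.coe_ne_bot _⟩) hgrad
  rw [zero_add] at h1
  convert h1 using 2
  ext u
  rw [add_assoc, ← EReal.coe_add]
  simp

theorem descent_of_step_le {a b αlo αhi β σ L μ M1 M2 t t' : ℝ} {yp y y' : E}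
    (hg : Differentiable ℝ g) (hgL : ∀ z w, ‖gradient g z - gradient g w‖ ≤ L * ‖z - w‖)
    (hF : Differentiable ℝ F) (hconv : ConvexOn ℝ Set.univ fun z => F z - σ / 2 * ‖z‖ ^ 2)
    (hσ : 0 ≤ σ) (hμ : 0 < μ) (hαlo : 0 < αlo) (ha : αlo ≤ a) (ha' : a ≤ αhi) (hb : 0 ≤ b)
    (hb' : b ≤ β) (hM1 : M1 = (σ - αhi * L) / (2 * αhi) - μ * β / (2 * αlo))
    (hM2 : M2 = β / (2 * μ * αlo))
    (hle : t' + a⁻¹ * stepObjective F g a b yp y y' ≤ t + a⁻¹ * stepObjective F g a b yp y y) :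
    t' + g y' + M1 * ‖y' - y‖ ^ 2 ≤ t + g y + M2 * ‖y - yp‖ ^ 2 := by
  have ha0 : 0 < a := hαlo.trans_le ha
  have hαhi : 0 < αhi := ha0.trans_le ha'
  have hdesc := le_add_inner_add_of_lipschitz_gradient hg hgL y y'
  have hsc := strongly_convex_le_bregman hconv hF y y'
  have hinv : αhi⁻¹ ≤ a⁻¹ := inv_anti₀ ha0 ha'
  have hba : a⁻¹ * b ≤ αlo⁻¹ * β :=
    mul_le_mul (inv_anti₀ hαlo ha) hb' hb (inv_pos.2 hαlo).le
  have hba0 : 0 ≤ a⁻¹ * b := mul_nonneg (inv_pos.2 ha0).le hb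
  have hsplit : t' + a⁻¹ * (F y' - F y - ⟪gradient F y, y' - y⟫) + ⟪gradient g y, y' - y⟫
      + a⁻¹ * b * ⟪y' - y, yp - y⟫ ≤ t := by
    simp only [stepObjective] at hle
    have e1 : a⁻¹ * (a * ⟪y', gradient g y⟫) = ⟪y', gradient g y⟫ :=
      inv_mul_cancel_left₀ ha0.ne' _
    have e2 : a⁻¹ * (a * ⟪y, gradient g y⟫) = ⟪y, gradient g y⟫ :=
      inv_mul_cancel_left₀ ha0.ne' _
    rw [real_inner_comm (y' - y) (gradient g y), inner_sub_left y' y, inner_sub_left y' y]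
    simp only [sub_self, inner_zero_right, zero_add, mul_add, e1, e2] at hle
    linarith
  have hbreg : αhi⁻¹ * (σ / 2 * ‖y' - y‖ ^ 2) ≤
      a⁻¹ * (F y' - F y - ⟪gradient F y, y' - y⟫) :=
    mul_le_mul hinv hsc (by positivity) (inv_pos.2 ha0).le
  have hyoung : ‖y' - y‖ * ‖y - yp‖ ≤ μ / 2 * ‖y' - y‖ ^ 2 + 1 / (2 * μ) * ‖y - yp‖ ^ 2 := by
    have h := sq_nonneg (μ * ‖y' - y‖ - ‖y - yp‖)
    have h2 : μ / 2 * ‖y' - y‖ ^ 2 + 1 / (2 * μ) * ‖y - yp‖ ^ 2 =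
      (μ ^ 2 * ‖y' - y‖ ^ 2 + ‖y - yp‖ ^ 2) / (2 * μ) := by field_simp
    rw [h2, le_div_iff₀ (by positivity)]
    linarith
  have hinner : -(αlo⁻¹ * β * (μ / 2 * ‖y' - y‖ ^ 2 + 1 / (2 * μ) * ‖y - yp‖ ^ 2)) ≤
      a⁻¹ * b * ⟪y' - y, yp - y⟫ := by
    have h1 := neg_le_of_abs_le (abs_real_inner_le_norm (y' - y) (yp - y))
    rw [norm_sub_rev yp y] at h1
    have h2 := mul_le_mul_of_nonneg_left h1 hba0
    have h3 := mul_le_mul hba hyoung (by positivity) (hba0.trans hba)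
    linarith
  have hM : M1 * ‖y' - y‖ ^ 2 - M2 * ‖y - yp‖ ^ 2 = αhi⁻¹ * (σ / 2 * ‖y' - y‖ ^ 2) -
      L / 2 * ‖y' - y‖ ^ 2 -
      αlo⁻¹ * β * (μ / 2 * ‖y' - y‖ ^ 2 + 1 / (2 * μ) * ‖y - yp‖ ^ 2) := by
    rw [hM1, hM2]
    field_simp
    ring
  linarith

theorem le_add_of_step_le {a b αlo β L t t' : ℝ} {yp y y' u : E} (hF : Differentiable ℝ F)
    (hFL : ∀ z w, ‖gradient F z - gradient F w‖ ≤ L * ‖z - w‖) (hL : 0 ≤ L) {σ : ℝ} (hσ : 0 ≤ σ)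
    (hconv : ConvexOn ℝ Set.univ fun z => F z - σ / 2 * ‖z‖ ^ 2)
    (hαlo : 0 < αlo) (ha : αlo ≤ a) (hb : 0 ≤ b) (hb' : b ≤ β)
    (hle : t' + a⁻¹ * stepObjective F g a b yp y y' ≤ t + a⁻¹ * stepObjective F g a b yp y u) :
    t' ≤ t + (αlo⁻¹ * (L / 2 * ‖u - y‖ ^ 2) + ⟪u - y', gradient g y⟫ +
      αlo⁻¹ * β * (‖u - y'‖ * ‖yp - y‖)) := by
  have ha0 : 0 < a := hαlo.trans_le ha
  have hinv := inv_anti₀ hαlo ha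
  have hinv0 := inv_pos.2 ha0
  have hba : a⁻¹ * b ≤ αlo⁻¹ * β := mul_le_mul hinv hb' hb (inv_pos.2 hαlo).le
  have hup := le_add_inner_add_of_lipschitz_gradient hF hFL y u
  have hlow : 0 ≤ a⁻¹ * (F y' - F y - ⟪gradient F y, y' - y⟫) :=
    mul_nonneg hinv0.le (le_trans (by positivity) (strongly_convex_le_bregman hconv hF y y'))
  have h1 : a⁻¹ * (F u - F y - ⟪gradient F y, u - y⟫) ≤ αlo⁻¹ * (L / 2 * ‖u - y‖ ^ 2) :=
    (mul_le_mul_of_nonneg_left (by linarith) hinv0.le).trans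
      (mul_le_mul_of_nonneg_right hinv (by positivity))
  have h2 : a⁻¹ * b * ⟪u - y', yp - y⟫ ≤ αlo⁻¹ * β * (‖u - y'‖ * ‖yp - y‖) :=
    (mul_le_mul_of_nonneg_left (real_inner_le_norm _ _) (mul_nonneg hinv0.le hb)).trans
      (mul_le_mul_of_nonneg_right hba (by positivity))
  have e1 : a⁻¹ * (a * ⟪y', gradient g y⟫) = ⟪y', gradient g y⟫ :=
    inv_mul_cancel_left₀ ha0.ne' _
  have e2 : a⁻¹ * (a * ⟪u, gradient g y⟫) = ⟪u, gradient g y⟫ :=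
    inv_mul_cancel_left₀ ha0.ne' _
  simp only [stepObjective, mul_add, e1, e2] at hle
  rw [inner_sub_left] at h2 ⊢
  linarith

theorem norm_gradient_sub_le {a b αlo β Lg LF : ℝ} {yp y y' : E}
    (hgL : ∀ z w, ‖gradient g z - gradient g w‖ ≤ Lg * ‖z - w‖)
    (hFL : ∀ z w, ‖gradient F z - gradient F w‖ ≤ LF * ‖z - w‖)
    (hαlo : 0 < αlo) (ha : αlo ≤ a) (hb : 0 ≤ b) (hb' : b ≤ β) :
    ‖gradient g y' - a⁻¹ • (gradient F y' - gradient F y + a • gradient g y + b • (yp - y))‖ ≤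
      (Lg + αlo⁻¹ * LF) * dist y y' + αlo⁻¹ * β * dist yp y := by
  have ha0 : 0 < a := hαlo.trans_le ha
  have hinv := inv_anti₀ hαlo ha
  have hinv0 := inv_pos.2 ha0
  have heq : gradient g y' -
      a⁻¹ • (gradient F y' - gradient F y + a • gradient g y + b • (yp - y)) =
      (gradient g y' - gradient g y) - a⁻¹ • (gradient F y' - gradient F y) -
        (a⁻¹ * b) • (yp - y) := by
    rw [smul_add, smul_add, inv_smul_smul₀ ha0.ne', mul_smul]
    abel
  rw [heq, dist_comm y y', dist_eq_norm, dist_eq_norm]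
  refine ((norm_sub_le _ _).trans (add_le_add_left (norm_sub_le _ _) _)).trans ?_
  rw [norm_smul, norm_smul, Real.norm_of_nonneg hinv0.le,
    Real.norm_of_nonneg (mul_nonneg hinv0.le hb)]
  have h1 := mul_le_mul hinv (hFL y' y) (norm_nonneg _) (inv_pos.2 hαlo).le
  have h2 := mul_le_mul_of_nonneg_right
    (mul_le_mul hinv hb' hb (inv_pos.2 hαlo).le) (norm_nonneg (yp - y))
  linarith [hgL y' y]

theorem hasGradientAt_mul_norm_fst_sub_snd_sq (M : ℝ) (p q : E) :
    HasGradientAt (fun z : WithLp 2 (E × E) => M * ‖z.fst - z.snd‖ ^ 2)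
      (WithLp.toLp 2 ((2 * M) • (p - q), -((2 * M) • (p - q)))) (WithLp.toLp 2 (p, q)) := by
  rw [hasGradientAt_iff_hasFDerivAt]
  have h := ((WithLp.fstL 2 ℝ E E - WithLp.sndL 2 ℝ E E).hasFDerivAt
    (x := WithLp.toLp 2 (p, q))).norm_sq.const_mul M
  refine h.congr_fderiv ?_
  ext v
  simp [inner_smul_left, inner_sub_left]
  ring

end BregmanStep
/-- Remark 3.9 (Theorem 3.7 under boundedness instead of coercivity): if `f + g` is
bounded below, the sequence generated by Algorithm 1 is bounded, and `H` is a KL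
function, then `∑ ‖x_{n+1} - x_n‖ < +∞` and the iterates converge to a critical point
of `f + g`. -/
theorem stmt16
    (m : ℕ)
    (f : EuclideanSpace ℝ (Fin m) → EReal)
    -- `f` is proper (never `⊥`, somewhere finite), lower semicontinuous and bounded below
    (hfbot : ∀ z, f z ≠ ⊥) (hfproper : ∃ z, f z ≠ ⊤)
    (hflsc : LowerSemicontinuous f)
    (hfbdd : ∃ cl : ℝ, ∀ z, (cl : EReal) ≤ f z)
    -- `g` is differentiable with `Lg`-Lipschitz gradient
    (g : EuclideanSpace ℝ (Fin m) → ℝ) (Lg : ℝ) (hLg : 0 ≤ Lg)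
    (hgdiff : Differentiable ℝ g)
    (hglip : ∀ z w, ‖gradient g z - gradient g w‖ ≤ Lg * ‖z - w‖)
    -- `F` is `σ`-strongly convex and differentiable with `LF`-Lipschitz gradient
    (F : EuclideanSpace ℝ (Fin m) → ℝ) (σ LF : ℝ) (hσ : 0 < σ) (hLF : 0 < LF)
    (hFconv : ConvexOn ℝ Set.univ fun z => F z - σ / 2 * ‖z‖ ^ 2)
    (hFdiff : Differentiable ℝ F)
    (hFlip : ∀ z w, ‖gradient F z - gradient F w‖ ≤ LF * ‖z - w‖)
    -- parameters of the algorithm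
    (αlo αhi β : ℝ) (hαlo : 0 < αlo) (hαorder : αlo ≤ αhi) (hβ : 0 ≤ β)
    (α βs : ℕ → ℝ)
    (hα : ∀ n, 1 ≤ n → αlo ≤ α n ∧ α n ≤ αhi)
    (hβs : ∀ n, 1 ≤ n → 0 ≤ βs n ∧ βs n ≤ β)
    -- the sequence generated by Algorithm 1:
    -- `x (n+1)` minimizes `u ↦ D_F(u, x n) + α n • ⟪u, ∇g(x n)⟫ + βs n • ⟪u, x (n-1) - x n⟫ + α n • f u`
    (x : ℕ → EuclideanSpace ℝ (Fin m))
    (halg : ∀ n, 1 ≤ n → ∀ u,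
      ((F (x (n + 1)) - F (x n) - ⟪gradient F (x n), x (n + 1) - x n⟫
          + α n * ⟪x (n + 1), gradient g (x n)⟫
          + βs n * ⟪x (n + 1), x (n - 1) - x n⟫ : ℝ) : EReal)
        + (α n : EReal) * f (x (n + 1))
      ≤ ((F u - F (x n) - ⟪gradient F (x n), u - x n⟫
          + α n * ⟪u, gradient g (x n)⟫
          + βs n * ⟪u, x (n - 1) - x n⟫ : ℝ) : EReal)
        + (α n : EReal) * f u)
    -- the parameters `μ, αlo, β` satisfy `μ(σ - Lg·αlo) > β(μ² + 1)` and `αhi` is chosen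
    -- with `αlo < αhi` such that `M1 > M2`
    (μ : ℝ) (hμ : 0 < μ)
    (hcond : β * (μ ^ 2 + 1) < μ * (σ - Lg * αlo))
    (M1 M2 : ℝ)
    (hM1 : M1 = (σ - αhi * Lg) / (2 * αhi) - μ * β / (2 * αlo))
    (hM2 : M2 = β / (2 * μ * αlo))
    (hαstrict : αlo < αhi) (hM : M2 < M1)

    -- `f + g` is bounded from below
    (hfgbdd : ∃ c : ℝ, ∀ z, (c : EReal) ≤ f z + ((g z : ℝ) : EReal))
    -- the sequence generated by Algorithm 1 is bounded
    (hxbdd : ∃ R : ℝ, ∀ n, ‖x n‖ ≤ R)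
    -- `H(x, y) = (f+g)(x) + M2‖x - y‖²` on the Euclidean product space
    (H : WithLp 2 (EuclideanSpace ℝ (Fin m) × EuclideanSpace ℝ (Fin m)) → EReal)
    (hH : ∀ p, H p = f (WithLp.equiv 2 _ p).1
      + ((g (WithLp.equiv 2 _ p).1 + M2 * ‖(WithLp.equiv 2 _ p).1 - (WithLp.equiv 2 _ p).2‖ ^ 2 : ℝ) : EReal))
    (hKL : KLFunction H) :
    Summable (fun n => ‖x (n + 1) - x n‖) ∧
    ∃ xb, (0 : EuclideanSpace ℝ (Fin m)) ∈
        limitingSubdiff (fun w => f w + ((g w : ℝ) : EReal)) xb ∧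
      Tendsto x atTop (𝓝 xb) := by
  have hσ' := hσ.le
  have hCpos : 0 < M1 - M2 := sub_pos.2 hM
  have hM2nn : 0 ≤ M2 := by rw [hM2]; positivity
  let A : ℕ → EuclideanSpace ℝ (Fin m) → ℝ := fun n =>
    stepObjective F g (α (n + 1)) (βs (n + 1)) (x n) (x (n + 1))
  have hαn : ∀ n, αlo ≤ α (n + 1) ∧ α (n + 1) ≤ αhi := fun n => hα _ n.succ_pos
  have hβn : ∀ n, 0 ≤ βs (n + 1) ∧ βs (n + 1) ≤ β := fun n => hβs _ n.succ_pos
  have hmin : ∀ n, f (x (n + 2)) ≠ ⊤ ∧ ∀ u, f (x (n + 2)) +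
      (((α (n + 1))⁻¹ * A n (x (n + 2)) : ℝ) : EReal) ≤
        f u + (((α (n + 1))⁻¹ * A n u : ℝ) : EReal) := fun n =>
    ne_top_and_forall_add_le_of_minimizer hfbot hfproper (hαlo.trans_le (hαn n).1)
      (halg (n + 1) n.succ_pos)
  have hfcoe : ∀ z, f z ≠ ⊤ → ((f z).toReal : EReal) = f z := fun z hz =>
    EReal.coe_toReal hz (hfbot z)
  have hstep : ∀ n u, f u ≠ ⊤ → (f (x (n + 2))).toReal + (α (n + 1))⁻¹ * A n (x (n + 2)) ≤
      (f u).toReal + (α (n + 1))⁻¹ * A n u := by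
    intro n u hu
    have := (hmin n).2 u
    rw [← hfcoe _ (hmin n).1, ← hfcoe _ hu] at this
    exact_mod_cast this
  set hv : ℕ → ℝ := fun n => (f (x (n + 2))).toReal + g (x (n + 2)) +
    M2 * ‖x (n + 2) - x (n + 1)‖ ^ 2 with hhv
  have hdesc : ∀ n, hv (n + 1) + (M1 - M2) * dist (x (n + 2)) (x (n + 3)) ^ 2 ≤ hv n := by
    intro n
    have := descent_of_step_le hgdiff hglip hFdiff hFconv hσ' hμ hαlo (hαn (n + 1)).1
      (hαn (n + 1)).2 (hβn (n + 1)).1 (hβn (n + 1)).2 hM1 hM2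
      (hstep (n + 1) (x (n + 2)) (hmin n).1)
    rw [dist_comm, dist_eq_norm]
    simp only [hhv, add_assoc, Nat.reduceAdd] at this ⊢
    linarith
  have hanti : Antitone hv := antitone_nat_of_succ_le fun n => by
    have := hdesc n
    have := mul_nonneg hCpos.le (sq_nonneg (dist (x (n + 2)) (x (n + 3))))
    linarith
  obtain ⟨ℓ, hlim⟩ : ∃ ℓ, Tendsto hv atTop (𝓝 ℓ) := by
    obtain ⟨c, hc⟩ := hfgbdd
    refine ⟨_, tendsto_atTop_ciInf hanti ⟨c, ?_⟩⟩
    rintro _ ⟨n, rfl⟩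
    have h1 := hc (x (n + 2))
    rw [← hfcoe _ (hmin n).1] at h1
    have h1 : c ≤ (f (x (n + 2))).toReal + g (x (n + 2)) := by exact_mod_cast h1
    have := mul_nonneg hM2nn (sq_nonneg ‖x (n + 2) - x (n + 1)‖)
    simp only [hhv]
    linarith
  have hD := tendsto_dist_of_sufficient_decrease hCpos hdesc hlim
  obtain ⟨R, hR⟩ := hxbdd
  obtain ⟨xb, -, φ, hφ, hxφ⟩ := tendsto_subseq_of_bounded
    (Metric.isBounded_closedBall (x := (0 : EuclideanSpace ℝ (Fin m))) (r := R))
    (x := x) (fun n => by simpa using hR n)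
  have hφt := hφ.tendsto_atTop
  have hshift : ∀ k, Tendsto (fun j => x (φ j + k)) atTop (𝓝 xb) →
      Tendsto (fun j => x (φ j + (k + 1))) atTop (𝓝 xb) := by
    intro k hk
    have hDk : Tendsto (fun j => dist (x (φ j + k)) (x (φ j + (k + 1)))) atTop (𝓝 0) :=
      hD.comp (tendsto_atTop_mono (fun j => Nat.le_add_right (φ j) k) hφt)
    exact hk.congr_dist hDk
  have hx1 : Tendsto (fun j => x (φ j + 1)) atTop (𝓝 xb) := hshift 0 hxφ
  have hx2 : Tendsto (fun j => x (φ j + 2)) atTop (𝓝 xb) := hshift 1 hx1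
  have hD1 : Tendsto (fun n => dist (x (n + 1)) (x (n + 2))) atTop (𝓝 0) :=
    (tendsto_add_atTop_iff_nat 1).2 hD
  have hval : Tendsto (fun n => (f (x (n + 2))).toReal + g (x (n + 2))) atTop (𝓝 ℓ) := by
    have h : Tendsto (fun n => ‖x (n + 2) - x (n + 1)‖) atTop (𝓝 0) :=
      hD1.congr fun n => by rw [dist_comm, dist_eq_norm]
    simpa [hhv] using hlim.sub ((h.pow 2).const_mul M2)
  have hfval : Tendsto (fun j => (f (x (φ j + 2))).toReal) atTop (𝓝 (ℓ - g xb)) := by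
    simpa using (hval.comp hφt).sub ((hgdiff.continuous.tendsto xb).comp hx2)
  have hfle : f xb ≤ ((ℓ - g xb : ℝ) : EReal) := hflsc.le_of_tendsto_comp hx2 <|
    ((continuous_coe_real_ereal.tendsto _).comp hfval).congr fun j => hfcoe _ (hmin (φ j)).1
  have hfxb : f xb ≠ ⊤ := ne_top_of_le_ne_top (EReal.coe_ne_top _) hfle
  have hfeq : (f xb).toReal + g xb = ℓ := by
    rw [← hfcoe _ hfxb, EReal.coe_le_coe_iff] at hfle
    have hgcont : Continuous (gradient g) :=
      (LipschitzWith.of_dist_le_mul (K := ⟨Lg, hLg⟩) fun z w => by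
        rw [dist_eq_norm, dist_eq_norm]
        exact hglip z w).continuous
    have hrhs : Tendsto (fun j => (f xb).toReal + (αlo⁻¹ * (LF / 2 * ‖xb - x (φ j + 1)‖ ^ 2) +
        ⟪xb - x (φ j + 2), gradient g (x (φ j + 1))⟫ +
        αlo⁻¹ * β * (‖xb - x (φ j + 2)‖ * ‖x (φ j) - x (φ j + 1)‖))) atTop
        (𝓝 (f xb).toReal) := by
      have h1 := ((((hx1.const_sub xb).norm.pow 2).const_mul (LF / 2)).const_mul αlo⁻¹)
      have h2 := (hx2.const_sub xb).inner (𝕜 := ℝ) ((hgcont.tendsto xb).comp hx1)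
      have h3 := ((hx2.const_sub xb).norm.mul (hxφ.sub hx1).norm).const_mul (αlo⁻¹ * β)
      simpa using ((h1.add h2).add h3).const_add (f xb).toReal
    have := le_of_tendsto_of_tendsto' hfval hrhs fun j =>
      le_add_of_step_le hFdiff hFlip hLF.le hσ' hFconv hαlo (hαn (φ j)).1 (hβn (φ j)).1
        (hβn (φ j)).2 (hstep (φ j) xb hfxb)
    linarith
  set Φ : EuclideanSpace ℝ (Fin m) → EReal := fun w => f w + (g w : EReal) with hΦ
  have hΦxb : Φ xb = ℓ := by
    rw [hΦ, ← hfeq, EReal.coe_add, hfcoe _ hfxb]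
  have hΦx : ∀ n, Φ (x (n + 2)) = (((f (x (n + 2))).toReal + g (x (n + 2)) : ℝ) : EReal) := by
    intro n
    rw [EReal.coe_add, hfcoe _ (hmin n).1]
  set p : ℕ → EuclideanSpace ℝ (Fin m) := fun n => gradient g (x (n + 2)) - (α (n + 1))⁻¹ •
    (gradient F (x (n + 2)) - gradient F (x (n + 1)) + α (n + 1) • gradient g (x (n + 1)) +
      βs (n + 1) • (x n - x (n + 1)))
  have hpmem : ∀ n, p n ∈ frechetSubdiff Φ (x (n + 2)) := fun n =>
    gradient_sub_mem_frechetSubdiff_add hFdiff hgdiff (hmin n).1 (hfbot _) (hmin n).2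
  have hpnorm : ∀ n, ‖p n‖ ≤ (Lg + αlo⁻¹ * LF) * dist (x (n + 1)) (x (n + 2)) +
      αlo⁻¹ * β * dist (x n) (x (n + 1)) := fun n =>
    norm_gradient_sub_le hglip hFlip hαlo (hαn n).1 (hβn n).1 (hβn n).2
  have hpzero : Tendsto p atTop (𝓝 0) := squeeze_zero_norm hpnorm (by
    simpa using (hD1.const_mul (Lg + αlo⁻¹ * LF)).add (hD.const_mul (αlo⁻¹ * β)))
  have hHΦ : H = fun z => Φ z.fst + ((M2 * ‖z.fst - z.snd‖ ^ 2 : ℝ) : EReal) := by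
    funext z
    rw [hH, EReal.coe_add, ← add_assoc]
    rfl
  set c : ℕ → EuclideanSpace ℝ (Fin m) := fun n => (2 * M2) • (x (n + 2) - x (n + 1)) with hc
  set w : ℕ → WithLp 2 (EuclideanSpace ℝ (Fin m) × EuclideanSpace ℝ (Fin m)) := fun n =>
    WithLp.toLp 2 (p n, 0) + WithLp.toLp 2 (c n, -c n) with hw
  have hwmem : ∀ n, w n ∈ frechetSubdiff H (WithLp.toLp 2 (x (n + 2), x (n + 1))) := by
    intro n
    rw [hHΦ]
    refine add_mem_frechetSubdiff (toLp_mem_frechetSubdiff_comp_fst (hpmem n) _) ?_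
      (hasGradientAt_mul_norm_fst_sub_snd_sq M2 _ _)
    change Φ (x (n + 2)) ≠ ⊥
    rw [hΦx]
    exact EReal.coe_ne_bot _
  have hcnorm : ∀ n, ‖c n‖ = 2 * M2 * dist (x (n + 1)) (x (n + 2)) := fun n => by
    rw [hc, norm_smul, Real.norm_of_nonneg (by positivity), dist_comm, dist_eq_norm]
  have hwnorm : ∀ n, ‖w n‖ ≤ (Lg + αlo⁻¹ * LF + 4 * M2 + αlo⁻¹ * β) *
      (dist (x (n + 1)) (x (n + 2)) + dist (x n) (x (n + 1))) := by
    intro n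
    have h1 := norm_toLp_add_toLp_le (p n) (c n)
    have h2 := hpnorm n
    rw [hcnorm] at h1
    have h3 : 0 ≤ (Lg + αlo⁻¹ * LF + 4 * M2) * dist (x n) (x (n + 1)) := by positivity
    have h4 : 0 ≤ αlo⁻¹ * β * dist (x (n + 1)) (x (n + 2)) := by positivity
    simp only [hw]
    linarith
  have hHval : ∀ n, H (WithLp.toLp 2 (x (n + 2), x (n + 1))) = hv n := by
    intro n
    rw [hHΦ, hhv, EReal.coe_add, ← hΦx]
    rfl
  have hHxb : H (WithLp.toLp 2 (xb, xb)) = ℓ := by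
    rw [hHΦ, ← hΦxb]
    simp
  have hwzero : Tendsto w atTop (𝓝 0) := squeeze_zero_norm hwnorm (by
    simpa using (hD1.add hD).const_mul (Lg + αlo⁻¹ * LF + 4 * M2 + αlo⁻¹ * β))
  have hcrit : (limitingSubdiff H (WithLp.toLp 2 (xb, xb))).Nonempty := by
    refine ⟨0, hHxb ▸ EReal.coe_ne_top _,
      fun j => WithLp.toLp 2 (x (φ j + 2), x (φ j + 1)), fun j => w (φ j), ?_, ?_,
      fun j => hwmem _, hwzero.comp hφt⟩
    · exact ((WithLp.prod_continuous_toLp 2 _ _).tendsto (xb, xb)).comp (hx2.prodMk_nhds hx1)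
    · simp only [hHval, hHxb]
      exact (continuous_coe_real_ereal.tendsto _).comp (hlim.comp hφt)
  obtain ⟨hsum, hxlim⟩ := (hKL _ hcrit).summable_dist_and_tendsto hCpos (by positivity) hHxb hHval
    hdesc hlim hwmem hwnorm hφ hxφ
  refine ⟨hsum.congr fun n => by rw [dist_comm, dist_eq_norm], xb, ⟨hΦxb ▸ EReal.coe_ne_top _,
    fun n => x (n + 2), p, (tendsto_add_atTop_iff_nat 2).2 hxlim, ?_, hpmem, hpzero⟩, hxlim⟩
  simp only [hΦx, hΦxb]
  exact (continuous_coe_real_ereal.tendsto _).comp hval
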